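/- (Combinatorial form of the deterministic comparison decision tree theorem.) There is a universal constant C > 0 such that the following holds. Let H ⊆ ℝ^n be a finite set with |H| ≥ 2 and inference dimension d ≥ 2. Then for every x ∈ ℝ^n there exists a subset S ⊆ H with |S| ≤ C·(d + n·log₂(n·d))·log₂|H| such that H ⊆ infer(S,x); that is, the sign pattern of x on S ∪ (S−S) determines sign⟨x,h⟩ for every h ∈ H. -/

import Mathlib

open Finset

namespace LDT

/-- The standard inner product on `ℝ^n`. -/
def ip {n : ℕ} (x h : Fin n → ℝ) : ℝ := ∑ i, x i * h i

/-- `S` infers `h` at `x`: the sign of `⟨x,h⟩` is determined by the signs of `⟨x,v⟩` for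
`v ∈ S ∪ (S - S)`, i.e. every `x'` with the same sign pattern as `x` on `S ∪ (S-S)` gives the
same sign on `h`. -/
def Infers {n : ℕ} (S : Finset (Fin n → ℝ)) (x h : Fin n → ℝ) : Prop :=
  ∀ x' : Fin n → ℝ,
    (∀ v ∈ S, SignType.sign (ip x' v) = SignType.sign (ip x v)) →
    (∀ v ∈ S, ∀ w ∈ S, SignType.sign (ip x' (v - w)) = SignType.sign (ip x (v - w))) →
    SignType.sign (ip x' h) = SignType.sign (ip x h)

/-- `H` has inference dimension at most `d`: every subset `S ⊆ H` of size at least `d` contains,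
for every `x`, an element `h` inferred by `S \ {h}` at `x`. -/
def InfProp {n : ℕ} (H : Finset (Fin n → ℝ)) (d : ℕ) : Prop :=
  ∀ S ⊆ H, d ≤ S.card → ∀ x : Fin n → ℝ, ∃ h ∈ S, Infers (S.erase h) x h

section Abstract

variable {α : Type*} [DecidableEq α] {P : Finset α → α → Prop} [∀ S, DecidablePred (P S)]

/-- If every set of size at least `d` has an element inferred by the others, then any set has
fewer than `d` elements not inferred by the others. -/
lemma card_filter_not_erase_lt (hmono : ∀ S T h, S ⊆ T → P S h → P T h) {H : Finset α} {d : ℕ}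
    (hH : ∀ S ⊆ H, d ≤ S.card → ∃ h ∈ S, P (S.erase h) h) {T : Finset α} (hT : T ⊆ H) :
    (T.filter fun h => ¬ P (T.erase h) h).card < d := by
  by_contra! hcard
  obtain ⟨h, hmem, hP⟩ := hH _ ((filter_subset _ _).trans hT) hcard
  exact (mem_filter.mp hmem).2 (hmono _ _ _ (erase_subset_erase _ (filter_subset _ _)) hP)

/-- Double counting of the pairs `(T, h)` with `h ∈ T` and `h` not inferred by `T \ {h}`. -/
lemma sum_card_filter_not_eq (H : Finset α) (k : ℕ) :
    ∑ S ∈ H.powersetCard k, (H.filter fun h => h ∉ S ∧ ¬ P S h).card =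
      ∑ T ∈ H.powersetCard (k + 1), (T.filter fun h => ¬ P (T.erase h) h).card := by
  rw [← card_sigma, ← card_sigma]
  refine card_bij' (fun p _ => ⟨insert p.2 p.1, p.2⟩) (fun p _ => ⟨p.1.erase p.2, p.2⟩)
    ?_ ?_ ?_ ?_
  · rintro ⟨S, h⟩ hp
    simp only [mem_sigma, mem_powersetCard, mem_filter] at hp ⊢
    obtain ⟨⟨hS, hc⟩, hh, hn, hP⟩ := hp
    refine ⟨⟨insert_subset hh hS, by rw [card_insert_of_notMem hn, hc]⟩, mem_insert_self _ _, ?_⟩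
    rwa [erase_insert hn]
  · rintro ⟨T, h⟩ hp
    simp only [mem_sigma, mem_powersetCard, mem_filter] at hp ⊢
    obtain ⟨⟨hT, hc⟩, hh, hP⟩ := hp
    exact ⟨⟨(erase_subset _ _).trans hT, by rw [card_erase_of_mem hh, hc]; rfl⟩, hT hh,
      notMem_erase _ _, hP⟩
  · rintro ⟨S, h⟩ hp
    simp only [mem_sigma, mem_filter] at hp
    simp [erase_insert hp.2.2.1]
  · rintro ⟨T, h⟩ hp
    simp only [mem_sigma, mem_filter] at hp
    simp [insert_erase hp.2.1]

/-- Some set of size less than `2 * d` infers at least half of `H`. -/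
lemma exists_infers_half (hmono : ∀ S T h, S ⊆ T → P S h → P T h) {H : Finset α} {d : ℕ}
    (hd : 0 < d) (hH : ∀ S ⊆ H, d ≤ S.card → ∃ h ∈ S, P (S.erase h) h)
    (hcard : 2 * d ≤ H.card) :
    ∃ S ⊆ H, S.card ≤ 2 * d ∧ 2 * (H.filter fun h => h ∉ S ∧ ¬ P S h).card ≤ H.card := by
  obtain ⟨k, hk⟩ : ∃ k, 2 * d = k + 1 := ⟨2 * d - 1, by omega⟩
  by_contra! hcon
  have hlow : H.card.choose k * (H.card - k) ≤
      2 * ∑ S ∈ H.powersetCard k, (H.filter fun h => h ∉ S ∧ ¬ P S h).card := by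
    rw [mul_sum, ← card_powersetCard k H]
    refine card_nsmul_le_sum _ _ _ fun S hS => ?_
    have hS' := mem_powersetCard.mp hS
    have := hcon S hS'.1 (by omega)
    omega
  have hup : ∑ T ∈ H.powersetCard (k + 1), (T.filter fun h => ¬ P (T.erase h) h).card ≤
      H.card.choose (k + 1) * (d - 1) := by
    rw [← card_powersetCard (k + 1) H]
    refine sum_le_card_nsmul _ _ _ fun T hT => ?_
    have := card_filter_not_erase_lt hmono hH (mem_powersetCard.mp hT).1
    omega
  rw [sum_card_filter_not_eq, ← Nat.choose_succ_right_eq, ← hk] at hlow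
  rw [← hk] at hup
  have hpos : 0 < H.card.choose (2 * d) := Nat.choose_pos hcard
  obtain ⟨e, rfl⟩ : ∃ e, d = e + 1 := ⟨d - 1, by omega⟩
  simp only [Nat.add_sub_cancel] at hup
  nlinarith

/-- Iterating `exists_infers_half` yields a small set inferring all of `H`. -/
lemma exists_infers_all (hmono : ∀ S T h, S ⊆ T → P S h → P T h)
    (hself : ∀ S, ∀ h ∈ S, P S h) {d : ℕ} (hd : 0 < d) (H : Finset α)
    (hH : ∀ S ⊆ H, d ≤ S.card → ∃ h ∈ S, P (S.erase h) h) :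
    ∃ S ⊆ H, S.card ≤ 2 * d * (Nat.log 2 H.card + 1) ∧ ∀ h ∈ H, P S h := by
  induction hN : H.card using Nat.strong_induction_on generalizing H with
  | _ N ih =>
    subst hN
    rcases lt_or_ge H.card (2 * d) with hlt | hge
    · exact ⟨H, Subset.rfl, by nlinarith [Nat.zero_le (Nat.log 2 H.card)], hself H⟩
    obtain ⟨S, hSH, hSc, hhalf⟩ := exists_infers_half hmono hd hH hge
    set B := H.filter fun h => h ∉ S ∧ ¬ P S h with hB
    have hBH : B ⊆ H := filter_subset _ _
    obtain ⟨S', hS'B, hS'c, hS'⟩ :=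
      ih B.card (by omega) B (fun T hT => hH T (hT.trans hBH)) rfl
    refine ⟨S ∪ S', union_subset hSH (hS'B.trans hBH), ?_, fun h hh => ?_⟩
    · have hlog : Nat.log 2 B.card + 1 ≤ Nat.log 2 H.card := by
        rw [Nat.log_of_one_lt_of_le one_lt_two (by omega : 2 ≤ H.card)]
        exact Nat.succ_le_succ (Nat.log_mono_right (by omega))
      have := Nat.mul_le_mul_left (2 * d) hlog
      have := card_union_le S S'
      linarith
    · by_cases hhB : h ∈ B
      · exact hmono _ _ _ subset_union_right (hS' h hhB)
      · have hPS : P S h := by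
          by_contra hn
          exact hhB (mem_filter.mpr ⟨hh, fun hm => hn (hself S h hm), hn⟩)
        exact hmono _ _ _ subset_union_left hPS

end Abstract

lemma Infers.mono {n : ℕ} {S T : Finset (Fin n → ℝ)} {x h : Fin n → ℝ} (hST : S ⊆ T)
    (hS : Infers S x h) : Infers T x h :=
  fun x' h₁ h₂ => hS x' (fun v hv => h₁ v (hST hv)) fun v hv w hw => h₂ v (hST hv) w (hST hw)

lemma infers_of_mem {n : ℕ} {S : Finset (Fin n → ℝ)} {x h : Fin n → ℝ} (hh : h ∈ S) :
    Infers S x h :=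
  fun _ h₁ _ => h₁ h hh

/-- Theorem 1.8, combinatorial form: there is a universal constant `C > 0`
such that for any finite `H ⊆ ℝ^n` with `|H| ≥ 2` and inference dimension `d ≥ 2`, and any
`x ∈ ℝ^n`, there is a subset `S ⊆ H` of size at most `C·(d + n·log₂(n·d))·log₂|H|` whose sign
pattern (on `S ∪ (S-S)`) at `x` determines `sign⟨x,h⟩` for every `h ∈ H`. -/
theorem deterministic_tree_combinatorial :
    ∃ C : ℝ, 0 < C ∧ ∀ (n : ℕ) (H : Finset (Fin n → ℝ)) (d : ℕ),
      2 ≤ H.card → 2 ≤ d → InfProp H d →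
      ∀ x : Fin n → ℝ,
        ∃ S ⊆ H,
          ((S.card : ℝ) ≤ C * (d + n * Real.logb 2 (n * d)) * Real.logb 2 H.card) ∧
          ∀ h ∈ H, Infers S x h := by
  classical
  refine ⟨4, by norm_num, fun n H d hH hd hinf x => ?_⟩
  obtain ⟨S, hSH, hSc, hS⟩ := exists_infers_all (P := fun S h => Infers S x h)
    (fun _ _ _ hST => Infers.mono hST) (fun _ _ => infers_of_mem) (by omega : 0 < d) H
    (fun S hS hc => by convert hinf S hS hc x)
  refine ⟨S, hSH, ?_, hS⟩
  have hlog : (Nat.log 2 H.card : ℝ) ≤ Real.logb 2 H.card := Real.natLog_le_logb _ _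
  have hone : (1 : ℝ) ≤ Real.logb 2 H.card := by
    rw [Real.le_logb_iff_rpow_le one_lt_two (by positivity), Real.rpow_one]
    exact_mod_cast hH
  have hn : 0 ≤ (n : ℝ) * Real.logb 2 (n * d) := by
    rcases Nat.eq_zero_or_pos n with rfl | hn
    · simp
    · refine mul_nonneg n.cast_nonneg (Real.logb_nonneg one_lt_two ?_)
      exact_mod_cast Nat.mul_pos hn (by omega : 0 < d)
  calc (S.card : ℝ) ≤ 2 * d * (Nat.log 2 H.card + 1) := by exact_mod_cast hSc
    _ ≤ 2 * d * (Real.logb 2 H.card + Real.logb 2 H.card) := by gcongr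
    _ = 4 * d * Real.logb 2 H.card := by ring
    _ ≤ 4 * (d + n * Real.logb 2 (n * d)) * Real.logb 2 H.card := by gcongr; linarith

end LDT
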